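/- There exists a constant C > 0 such that for every f ∈ L¹(λ) and every η > 0, λ({x ∈ ℝ : M_λ f(x) > η}) ≤ (C/η) ∫_ℝ |f(y)| dλ(y), i.e. the Hardy–Littlewood maximal operator with respect to λ is of weak type (1,1) with respect to λ. -/

import Mathlib

open MeasureTheory Real Set

/-- The measure dλ(x) = |x|^{2μ} e^{-x²} dx on ℝ. -/
noncomputable def lam (μ : ℝ) : Measure ℝ :=
  volume.withDensity (fun x => ENNReal.ofReal (|x| ^ (2 * μ) * Real.exp (-x ^ 2)))

/-- The Hardy–Littlewood maximal function with respect to λ: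
M_λ f(x) = sup over bounded intervals I ∋ x with λ(I) > 0 of (1/λ(I)) ∫_I |f| dλ. -/
noncomputable def maxFn (μ : ℝ) (f : ℝ → ℝ) (x : ℝ) : ℝ :=
  sSup {v : ℝ | ∃ a b : ℝ, a ≤ x ∧ x ≤ b ∧ 0 < lam μ (Set.Icc a b) ∧
    v = (∫ y in Set.Icc a b, |f y| ∂(lam μ)) / (lam μ (Set.Icc a b)).toReal}

section Covering

variable {α : Type*} [LinearOrder α] [TopologicalSpace α] [OrderTopology α]
  [SecondCountableTopology α] [MeasurableSpace α]

/-- A set all of whose upper parts have measure at most `c` has itself measure at most `c`. -/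
theorem measure_le_of_forall_measure_inter_Ici_le {ν : Measure α} {A : Set α} {c : ENNReal}
    (h : ∀ x ∈ A, ν (A ∩ Ici x) ≤ c) : ν A ≤ c := by
  by_cases hmin : ∃ x, IsLeast A x
  · obtain ⟨x, hx, hlb⟩ := hmin
    exact (measure_mono (t := A ∩ Ici x) fun y hy => ⟨hy, hlb hy⟩).trans (h x hx)
  · obtain ⟨T, hTA, hT, hU⟩ :=
      TopologicalSpace.isOpen_biUnion_countable A (fun x => Ioi x) fun _ _ => isOpen_Ioi
    have hsub : A ⊆ ⋃ x ∈ T, A ∩ Ici x := by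
      intro y hy
      obtain ⟨z, hz, hzy⟩ : ∃ z ∈ A, z < y := by
        by_contra! hcon
        exact hmin ⟨y, hy, hcon⟩
      have hmem : y ∈ ⋃ x ∈ T, Ioi x := hU ▸ mem_biUnion hz hzy
      obtain ⟨x, hx, hxy⟩ := mem_iUnion₂.1 hmem
      exact mem_biUnion hx ⟨hy, le_of_lt hxy⟩
    refine (measure_mono hsub).trans ?_
    rw [measure_biUnion_eq_iSup hT]
    · exact iSup₂_le fun x hx => h x (hTA hx)
    · intro x hx y hy
      rcases le_total x y with hxy | hxy
      · exact ⟨x, hx, subset_rfl, inter_subset_inter_right _ (Ici_subset_Ici.2 hxy)⟩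
      · exact ⟨y, hy, inter_subset_inter_right _ (Ici_subset_Ici.2 hxy), subset_rfl⟩

theorem measure_le_of_forall_measure_inter_Iic_le {ν : Measure α} {A : Set α} {c : ENNReal}
    (h : ∀ x ∈ A, ν (A ∩ Iic x) ≤ c) : ν A ≤ c :=
  measure_le_of_forall_measure_inter_Ici_le (α := αᵒᵈ) (ν := ν) (A := A) h

/-- The union of the intervals of measure at most `c` that meet `[p, q]` has measure at most
`ν [p, q] + c + c`. -/
theorem measure_setOf_mem_Icc_inter_nonempty_le (ν : Measure α) (p q : α) (c : ENNReal) :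
    ν {x | ∃ u v, x ∈ Icc u v ∧ (Icc u v ∩ Icc p q).Nonempty ∧ ν (Icc u v) ≤ c} ≤
      ν (Icc p q) + c + c := by
  have hL : ν {x | x ≤ p ∧ ν (Icc x p) ≤ c} ≤ c :=
    measure_le_of_forall_measure_inter_Ici_le fun x hx =>
      (measure_mono (t := Icc x p) fun y hy => ⟨hy.2, hy.1.1⟩).trans hx.2
  have hR : ν {x | q ≤ x ∧ ν (Icc q x) ≤ c} ≤ c :=
    measure_le_of_forall_measure_inter_Iic_le fun x hx =>
      (measure_mono (t := Icc q x) fun y hy => ⟨hy.1.1, hy.2⟩).trans hx.2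
  have hsub : {x | ∃ u v, x ∈ Icc u v ∧ (Icc u v ∩ Icc p q).Nonempty ∧ ν (Icc u v) ≤ c} ⊆
      Icc p q ∪ {x | x ≤ p ∧ ν (Icc x p) ≤ c} ∪ {x | q ≤ x ∧ ν (Icc q x) ≤ c} := by
    rintro x ⟨u, v, hx, ⟨z, hz, hz'⟩, hc⟩
    rcases le_total x p with hxp | hpx
    · exact Or.inl (Or.inr ⟨hxp,
        (measure_mono (Icc_subset_Icc hx.1 (hz'.1.trans hz.2))).trans hc⟩)
    rcases le_total q x with hqx | hxq
    · exact Or.inr ⟨hqx, (measure_mono (Icc_subset_Icc (hz.1.trans hz'.2) hx.2)).trans hc⟩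
    · exact Or.inl (Or.inl ⟨hpx, hxq⟩)
  refine (measure_mono hsub).trans ((measure_union_le _ _).trans ?_)
  gcongr
  refine (measure_union_le _ _).trans ?_
  gcongr

/-- The weak type (1,1) bound for the uncentred maximal operator on a line, for an arbitrary
s-finite measure. -/
theorem mul_measure_le_of_forall_mem_Icc [OpensMeasurableSpace α] (ν : Measure α) [SFinite ν]
    {g : α → ENNReal} (hg : ∫⁻ y, g y ∂ν ≠ ⊤) {η : ENNReal} (hη : η ≠ 0) {E : Set α}
    (hE : ∀ x ∈ E, ∃ a b, x ∈ Icc a b ∧ ν (Icc a b) ≠ 0 ∧ ν (Icc a b) ≠ ⊤ ∧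
      η * ν (Icc a b) ≤ ∫⁻ y in Icc a b, g y ∂ν) :
    η * ν E ≤ 5 * ∫⁻ y, g y ∂ν := by
  let B : α × α → Set α := fun i => Icc i.1 i.2
  let t : Set (α × α) :=
    {i | ν (B i) ≠ 0 ∧ ν (B i) ≠ ⊤ ∧ η * ν (B i) ≤ ∫⁻ y in B i, g y ∂ν}
  have hbound : ∀ i ∈ t, (ν (B i)).toReal ≤ ((∫⁻ y, g y ∂ν) / η).toReal := by
    intro i hi
    refine ENNReal.toReal_mono (ENNReal.div_ne_top hg hη) ?_
    rw [ENNReal.le_div_iff_mul_le (Or.inl hη) (Or.inr hg), mul_comm]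
    exact hi.2.2.trans (setLIntegral_le_lintegral _ _)
  obtain ⟨u, hut, hdisj, hcov⟩ := Vitali.exists_disjoint_subfamily_covering_enlargement B t
    (fun i => (ν (B i)).toReal) 2 one_lt_two (fun _ _ => ENNReal.toReal_nonneg) _ hbound
    (fun i hi => nonempty_of_measure_ne_zero hi.1)
  have hBm : ∀ i, MeasurableSet (B i) := fun i => measurableSet_Icc
  have hu : u.Countable := by
    have := Measure.countable_meas_pos_of_disjoint_iUnion (μ := ν) (As := fun i : u => B i)
      (fun i => hBm i) (hdisj.subtype _ _)
    have huniv : {i : u | 0 < ν (B i)} = univ :=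
      eq_univ_of_forall fun i => pos_iff_ne_zero.2 (hut i.2).1
    rw [huniv] at this
    exact countable_coe_iff.1 (countable_univ_iff.1 this)
  have hEsub : E ⊆ ⋃ i ∈ u, {x | ∃ a b, x ∈ Icc a b ∧ (Icc a b ∩ Icc i.1 i.2).Nonempty ∧
      ν (Icc a b) ≤ 2 * ν (Icc i.1 i.2)} := by
    intro x hx
    obtain ⟨a, b, hxab, hab⟩ := hE x hx
    obtain ⟨i, hi, hne, hle⟩ := hcov (a, b) hab
    refine mem_biUnion hi ⟨a, b, hxab, hne, ?_⟩
    rw [← ENNReal.toReal_le_toReal hab.2.1 (ENNReal.mul_ne_top ENNReal.ofNat_ne_top (hut hi).2.1)]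
    simpa using hle
  calc η * ν E ≤ η * ∑' i : u, 5 * ν (B i) := by
        gcongr
        refine (measure_mono hEsub).trans ((measure_biUnion_le ν hu _).trans ?_)
        refine ENNReal.tsum_le_tsum fun i =>
          (measure_setOf_mem_Icc_inter_nonempty_le ν i.1.1 i.1.2 _).trans (le_of_eq ?_)
        change ν (B i) + 2 * ν (B i) + 2 * ν (B i) = _
        ring
    _ = 5 * ∑' i : u, η * ν (B i) := by
        rw [ENNReal.tsum_mul_left, ENNReal.tsum_mul_left]
        ring
    _ ≤ 5 * ∑' i : u, ∫⁻ y in B i, g y ∂ν := by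
        gcongr with i
        exact (hut i.2).2.2
    _ = 5 * ∫⁻ y in ⋃ i ∈ u, B i, g y ∂ν := by
        rw [lintegral_biUnion hu (fun i _ => hBm i) hdisj]
    _ ≤ 5 * ∫⁻ y, g y ∂ν := by
        gcongr
        exact Measure.restrict_le_self

end Covering

/-- The Hardy–Littlewood maximal operator with respect to λ is of weak type (1,1). -/
theorem maxFn_weak_type_one_one (μ : ℝ) (hμ : -1 / 2 < μ) :
    ∃ C : ℝ, 0 < C ∧ ∀ f : ℝ → ℝ, Integrable f (lam μ) → ∀ η : ℝ, 0 < η →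
      lam μ {x : ℝ | η < maxFn μ f x} ≤
        ENNReal.ofReal (C / η * ∫ y, |f y| ∂(lam μ)) := by
  refine ⟨5, by norm_num, fun f hf η hη => ?_⟩
  have : SFinite (lam μ) := by unfold lam; infer_instance
  have hint : ENNReal.ofReal (∫ y, |f y| ∂(lam μ)) = ∫⁻ y, ENNReal.ofReal |f y| ∂(lam μ) :=
    ofReal_integral_eq_lintegral_ofReal hf.abs (.of_forall fun _ => abs_nonneg _)
  have key := mul_measure_le_of_forall_mem_Icc (lam μ) (g := fun y => ENNReal.ofReal |f y|)
    (hint ▸ ENNReal.ofReal_ne_top) (ENNReal.ofReal_pos.2 hη).ne'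
    (E := {x : ℝ | η < maxFn μ f x}) ?_
  · rw [← hint, mul_comm, ← ENNReal.le_div_iff_mul_le
      (Or.inl (ENNReal.ofReal_pos.2 hη).ne') (Or.inl ENNReal.ofReal_ne_top)] at key
    refine key.trans (le_of_eq ?_)
    rw [div_mul_eq_mul_div, ENNReal.ofReal_div_of_pos hη, ENNReal.ofReal_mul (by norm_num),
      ENNReal.ofReal_ofNat]
  · intro x hx
    rw [mem_ofPred_eq, maxFn] at hx
    obtain ⟨_, ⟨a, b, hax, hxb, hpos, rfl⟩, hlt⟩ := exists_lt_of_lt_csSup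
      (nonempty_iff_ne_empty.2 fun h => by
        rw [h, Real.sSup_empty] at hx
        exact hx.not_gt hη) hx
    have htop : lam μ (Icc a b) ≠ ⊤ := fun h => by
      rw [h, ENNReal.toReal_top, div_zero] at hlt
      exact hlt.not_gt hη
    refine ⟨a, b, ⟨hax, hxb⟩, hpos.ne', htop, ?_⟩
    rw [lt_div_iff₀ (ENNReal.toReal_pos hpos.ne' htop)] at hlt
    rw [← ofReal_integral_eq_lintegral_ofReal hf.abs.integrableOn
      (.of_forall fun _ => abs_nonneg _), ← ENNReal.ofReal_toReal htop, ← ENNReal.ofReal_mul hη.le]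
    exact ENNReal.ofReal_le_ofReal hlt.le
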